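/- Let C be a nontrivial linear code of length n over GF(q). If the automorphism group Aut(C) is transitive, or the automorphism group Aut(C⊥) is transitive, then C has minimum linear locality d(C⊥) − 1 and C⊥ has minimum linear locality d(C) − 1. -/

import Mathlib

open scoped BigOperators

variable {F : Type*} [Field F] {ι : Type*} [Fintype ι]

/-- The Hamming weight of a word: the number of nonzero coordinates. -/
noncomputable def wt (c : ι → F) : ℕ := {i | c i ≠ 0}.ncard

/-- The minimum distance of a linear code: the least Hamming weight of a nonzero codeword. -/
noncomputable def minDist (C : Submodule F (ι → F)) : ℕ :=
  sInf {w | ∃ c ∈ C, c ≠ 0 ∧ wt c = w}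

/-- The dual code of a linear code. -/
def dualCode (C : Submodule F (ι → F)) : Submodule F (ι → F) where
  carrier := {x | ∀ c ∈ C, ∑ i, x i * c i = 0}
  add_mem' := by
    intro a b ha hb c hc
    have h1 := ha c hc
    have h2 := hb c hc
    simp only [Set.mem_setOf_eq, Pi.add_apply, add_mul, Finset.sum_add_distrib, h1, h2, add_zero]
  zero_mem' := by intro c hc; simp
  smul_mem' := by
    intro r a ha c hc
    have h := ha c hc
    simp only [Set.mem_setOf_eq, Pi.smul_apply, smul_eq_mul, mul_assoc, ← Finset.mul_sum, h,
      mul_zero]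

/-- `C` has linear locality `r`: every code symbol `c i` is a fixed linear combination of
at most `r` other code symbols. -/
def HasLinearLocality (C : Submodule F (ι → F)) (r : ℕ) : Prop :=
  ∀ i : ι, ∃ (R : Finset ι) (u : ι → F), i ∉ R ∧ R.card ≤ r ∧
    ∀ c ∈ C, c i = ∑ j ∈ R, u j * c j

/-- The map `x ↦ (d i * γ (x (σ i)))ᵢ` given by a monomial transformation together with a field
automorphism `γ`. -/
def autMap (σ : Equiv.Perm ι) (d : ι → F) (γ : F ≃+* F) (x : ι → F) : ι → F :=
  fun i => d i * γ (x (σ i))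

/-- `(σ, d, γ)` is an automorphism of the code `C`: all `d i` are nonzero and the corresponding
map carries `C` onto `C`. -/
def IsCodeAut (C : Submodule F (ι → F)) (σ : Equiv.Perm ι) (d : ι → F) (γ : F ≃+* F) : Prop :=
  (∀ i, d i ≠ 0) ∧ ∀ x : ι → F, autMap σ d γ x ∈ C ↔ x ∈ C

/-- The automorphism group of `C` is transitive: for all coordinates `i, j` there is an
automorphism of `C` whose permutation part sends `i` to `j`. -/
def AutTransitive (C : Submodule F (ι → F)) : Prop :=
  ∀ i j : ι, ∃ (σ : Equiv.Perm ι) (d : ι → F) (γ : F ≃+* F), IsCodeAut C σ d γ ∧ σ i = j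

theorem dualCode_dualCode (C : Submodule F (ι → F)) : dualCode (dualCode C) = C := by
  classical
  refine le_antisymm (fun x hx => ?_) fun x hx y hy => ?_
  · by_contra hxC
    obtain ⟨f, hfx, hfC⟩ := Submodule.exists_le_ker_of_notMem hxC
    have hf : ∀ y, f y = ∑ i, y i * f (Pi.single i 1) := fun y => by
      conv_lhs => rw [← Finset.univ_sum_single y]
      simp only [map_sum]
      refine Finset.sum_congr rfl fun i _ => ?_
      rw [← smul_eq_mul, ← map_smul, ← Pi.single_smul, smul_eq_mul, mul_one]
    refine hfx ?_
    rw [hf]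
    refine hx (fun i => f (Pi.single i 1)) fun c hc => ?_
    simpa [hf c, mul_comm] using hfC hc
  · simpa [mul_comm] using hy x hx

omit [Fintype ι] in
theorem minDist_le_wt {C : Submodule F (ι → F)} {c : ι → F} (hc : c ∈ C) (h0 : c ≠ 0) :
    minDist C ≤ wt c :=
  Nat.sInf_le ⟨c, hc, h0, rfl⟩

omit [Fintype ι] in
theorem exists_wt_eq_minDist {C : Submodule F (ι → F)} (h : minDist C ≠ 0) :
    ∃ c ∈ C, c ≠ 0 ∧ wt c = minDist C :=
  Nat.sInf_mem (Nat.nonempty_of_pos_sInf (Nat.pos_of_ne_zero h))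

omit [Fintype ι] in
theorem wt_autMap {σ : Equiv.Perm ι} {d : ι → F} (hd : ∀ i, d i ≠ 0) (γ : F ≃+* F) (x : ι → F) :
    wt (autMap σ d γ x) = wt x := by
  have h : {i | autMap σ d γ x i ≠ 0} = σ ⁻¹' {i | x i ≠ 0} := by
    ext i
    simp [autMap, hd i]
  rw [wt, h, Set.ncard_preimage_of_injective_subset_range σ.injective (by simp), wt]

omit [Fintype ι] in
theorem autMap_surjective {σ : Equiv.Perm ι} {d : ι → F} (hd : ∀ i, d i ≠ 0) (γ : F ≃+* F) :
    Function.Surjective (autMap σ d γ) := fun y =>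
  ⟨fun i => γ.symm ((d (σ.symm i))⁻¹ * y (σ.symm i)), by
    ext i
    simp [autMap, hd i]⟩

theorem sum_autMap_inv_mul_autMap {σ : Equiv.Perm ι} {d : ι → F} (hd : ∀ i, d i ≠ 0)
    (γ : F ≃+* F) (x c : ι → F) :
    ∑ i, autMap σ d⁻¹ γ x i * autMap σ d γ c i = γ (∑ i, x i * c i) := by
  rw [map_sum, ← Equiv.sum_comp σ fun i => γ (x i * c i)]
  refine Finset.sum_congr rfl fun i _ => ?_
  have := hd i
  simp only [autMap, Pi.inv_apply, map_mul]
  field_simp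

theorem IsCodeAut.dualCode {C : Submodule F (ι → F)} {σ : Equiv.Perm ι} {d : ι → F} {γ : F ≃+* F}
    (h : IsCodeAut C σ d γ) : IsCodeAut (dualCode C) σ d⁻¹ γ := by
  refine ⟨fun i => inv_ne_zero (h.1 i), fun x => ⟨fun hx c hc => ?_, fun hx c hc => ?_⟩⟩
  · have := hx _ ((h.2 c).2 hc)
    rwa [sum_autMap_inv_mul_autMap h.1, map_eq_zero_iff γ γ.injective] at this
  · obtain ⟨c, rfl⟩ := autMap_surjective (σ := σ) h.1 γ c
    rw [sum_autMap_inv_mul_autMap h.1, hx c ((h.2 c).1 hc), map_zero]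

theorem AutTransitive.dualCode {C : Submodule F (ι → F)} (h : AutTransitive C) :
    AutTransitive (dualCode C) := fun i j =>
  let ⟨σ, d, γ, hA, hij⟩ := h i j
  ⟨σ, d⁻¹, γ, hA.dualCode, hij⟩

omit [Fintype ι] in
theorem AutTransitive.exists_wt_eq_minDist {C : Submodule F (ι → F)} (h : AutTransitive C)
    (h0 : minDist C ≠ 0) (i : ι) : ∃ c ∈ C, c i ≠ 0 ∧ wt c = minDist C := by
  obtain ⟨x, hxC, hx0, hx⟩ := _root_.exists_wt_eq_minDist h0
  obtain ⟨j, hj⟩ := Function.ne_iff.1 hx0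
  obtain ⟨σ, d, γ, hA, rfl⟩ := h i j
  exact ⟨autMap σ d γ x, (hA.2 x).2 hxC, by simpa [autMap, hA.1 i] using hj,
    (wt_autMap hA.1 γ x).trans hx⟩

theorem HasLinearLocality.minDist_dualCode_le [Nonempty ι] {C : Submodule F (ι → F)} {r : ℕ}
    (h : HasLinearLocality C r) : minDist (dualCode C) ≤ r + 1 := by
  classical
  obtain ⟨i⟩ := ‹Nonempty ι›
  obtain ⟨R, u, hi, hR, hu⟩ := h i
  let x : ι → F := fun j => (if j = i then 1 else 0) - if j ∈ R then u j else 0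
  have hx : x ∈ dualCode C := fun c hc => by
    simp [x, sub_mul, Finset.sum_sub_distrib, ite_mul, hu c hc]
  have hx0 : x ≠ 0 := fun h => by simpa [x, hi] using congrFun h i
  refine (minDist_le_wt hx hx0).trans ?_
  have hsub : {j | x j ≠ 0} ⊆ (insert i R : Finset ι) := fun j hj => by
    by_contra hn
    simp only [Finset.coe_insert, Set.mem_insert_iff, Finset.mem_coe, not_or] at hn
    exact hj (by simp [x, hn])
  calc wt x ≤ (insert i R).card := by
        simpa only [wt, Set.ncard_coe_finset] using Set.ncard_le_ncard hsub (Finset.finite_toSet _)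
    _ ≤ r + 1 := by rw [Finset.card_insert_of_notMem hi]; lia

theorem hasLinearLocality_of_forall_exists {C : Submodule F (ι → F)} {w : ℕ}
    (h : ∀ i, ∃ x ∈ dualCode C, x i ≠ 0 ∧ wt x = w) : HasLinearLocality C (w - 1) := by
  classical
  intro i
  obtain ⟨x, hx, hxi, rfl⟩ := h i
  have hmem : i ∈ Finset.univ.filter fun j => x j ≠ 0 := by simpa using hxi
  refine ⟨(Finset.univ.filter fun j => x j ≠ 0).erase i, fun j => -(x i)⁻¹ * x j, by simp, ?_,
    fun c hc => ?_⟩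
  · rw [Finset.card_erase_of_mem hmem, wt, ← Set.ncard_coe_finset]
    simp
  · have hsum : ∑ j ∈ Finset.univ.filter (fun j => x j ≠ 0), x j * c j = 0 := by
      rw [Finset.sum_filter_of_ne fun j _ hj => left_ne_zero_of_mul hj]
      exact hx c hc
    rw [← Finset.add_sum_erase _ _ hmem] at hsum
    simp only [mul_assoc, ← Finset.mul_sum]
    rw [eq_neg_of_add_eq_zero_right hsum]
    field_simp

theorem AutTransitive.isLeast_hasLinearLocality {C : Submodule F (ι → F)}
    (h : AutTransitive (_root_.dualCode C)) (h0 : minDist (_root_.dualCode C) ≠ 0) :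
    IsLeast {r : ℕ | HasLinearLocality C r} (minDist (_root_.dualCode C) - 1) := by
  refine ⟨hasLinearLocality_of_forall_exists (h.exists_wt_eq_minDist h0), fun r hr => ?_⟩
  obtain ⟨x, -, hx, -⟩ := _root_.exists_wt_eq_minDist h0
  have : Nonempty ι := ⟨(Function.ne_iff.1 hx).choose⟩
  exact Nat.sub_le_of_le_add hr.minDist_dualCode_le

/-- If `Aut(C)` or `Aut(C⊥)` is transitive, then the nontrivial code `C` has
minimum linear locality `d(C⊥) - 1` and `C⊥` has minimum linear locality `d(C) - 1`. -/
theorem statement4 (C : Submodule F (ι → F))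
    (h1 : 2 ≤ minDist C) (h2 : 2 ≤ minDist (dualCode C))
    (htrans : AutTransitive C ∨ AutTransitive (dualCode C)) :
    IsLeast {r : ℕ | HasLinearLocality C r} (minDist (dualCode C) - 1) ∧
    IsLeast {r : ℕ | HasLinearLocality (dualCode C) r} (minDist C - 1) := by
  have hdual : AutTransitive (dualCode C) := htrans.elim AutTransitive.dualCode id
  refine ⟨hdual.isLeast_hasLinearLocality (by lia), ?_⟩
  have h := hdual.dualCode.isLeast_hasLinearLocality
  rw [dualCode_dualCode] at h
  exact h (by lia)
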